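/- Let e_z, e_x, e_y be real numbers such that q_i := (1+e_z+e_x+e_y)/4, q_z := (1+e_z−e_x−e_y)/4, q_x := (1−e_z+e_x−e_y)/4, q_y := (1−e_z−e_x+e_y)/4 are all nonnegative, let A, B ∈ SO(3), and let R = B·diag(e_z,e_x,e_y)·A. Set H := −(q_i log₂ q_i + q_z log₂ q_z + q_x log₂ q_x + q_y log₂ q_y), and for a real 3×3 matrix M define K(M) := 1 − H + h₂((1+‖M e₁‖)/2) − h₂((1+M₁₁)/2). Then there exists O_B ∈ SO(3) such that K(O_B·R) = 1 − H; consequently the supremum of K(O_B·R) over O_B ∈ SO(3) (one-side compensation) equals the supremum of K(O_B·R·O_A) over O_A, O_B ∈ SO(3) (two-side compensation), both equal to 1 − H. In particular any O_B ∈ SO(3) whose first row is a scalar multiple of the first column of R achieves the equality. -/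

import Mathlib

/-- Binary entropy function (base-2 logarithm), with the convention `0 * log 0 = 0`. -/
noncomputable def h2 (p : ℝ) : ℝ := -(p * Real.logb 2 p) - (1 - p) * Real.logb 2 (1 - p)

/-- `M` is a real 3×3 special orthogonal matrix. -/
def SO3 (M : Matrix (Fin 3) (Fin 3) ℝ) : Prop := M.transpose * M = 1 ∧ M.det = 1

/-- Euclidean norm of the first column of a 3×3 real matrix. -/
noncomputable def colNorm3 (M : Matrix (Fin 3) (Fin 3) ℝ) : ℝ :=
  Real.sqrt ((M 0 0) ^ 2 + (M 1 0) ^ 2 + (M 2 0) ^ 2)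

theorem h2_eq_binEntropy_div (p : ℝ) : h2 p = Real.binEntropy p / Real.log 2 := by
  simp only [h2, Real.logb, Real.binEntropy_eq_negMulLog_add_negMulLog_one_sub, Real.negMulLog]
  ring

theorem h2_half_one_add_abs (x : ℝ) : h2 ((1 + |x|) / 2) = h2 ((1 + x) / 2) := by
  rcases abs_choice x with h | h
  · rw [h]
  · rw [h, h2_eq_binEntropy_div, h2_eq_binEntropy_div, ← Real.binEntropy_one_sub]
    congr 2
    ring

theorem h2_half_one_add_le {x y : ℝ} (hxy : |x| ≤ y) (hy : y ≤ 1) :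
    h2 ((1 + y) / 2) ≤ h2 ((1 + x) / 2) := by
  rw [← h2_half_one_add_abs x, h2_eq_binEntropy_div, h2_eq_binEntropy_div]
  have hx := abs_nonneg x
  refine div_le_div_of_nonneg_right ?_ (Real.log_nonneg one_le_two)
  refine Real.binEntropy_strictAntiOn.antitoneOn ⟨?_, ?_⟩ ⟨?_, ?_⟩ ?_ <;> linarith

theorem abs_le_colNorm3 (M : Matrix (Fin 3) (Fin 3) ℝ) : |M 0 0| ≤ colNorm3 M :=
  Real.abs_le_sqrt (by nlinarith [sq_nonneg (M 1 0), sq_nonneg (M 2 0)])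

theorem colNorm3_eq_sqrt_transpose_mul (M : Matrix (Fin 3) (Fin 3) ℝ) :
    colNorm3 M = Real.sqrt ((M.transpose * M) 0 0) := by
  simp only [colNorm3, Matrix.mul_apply, Fin.sum_univ_three, Matrix.transpose_apply, sq]

theorem colNorm3_eq_abs {M : Matrix (Fin 3) (Fin 3) ℝ} (h₁ : M 1 0 = 0) (h₂ : M 2 0 = 0) :
    colNorm3 M = |M 0 0| := by
  simp [colNorm3, h₁, h₂, Real.sqrt_sq_eq_abs]

theorem SO3.one : SO3 1 := by simp [SO3]

theorem SO3.mul {M N : Matrix (Fin 3) (Fin 3) ℝ} (hM : SO3 M) (hN : SO3 N) : SO3 (M * N) := by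
  refine ⟨?_, by rw [Matrix.det_mul, hM.2, hN.2, one_mul]⟩
  rw [Matrix.transpose_mul, Matrix.mul_assoc, ← Matrix.mul_assoc M.transpose, hM.1,
    Matrix.one_mul, hN.1]

theorem SO3.mul_transpose {M : Matrix (Fin 3) (Fin 3) ℝ} (hM : SO3 M) : M * M.transpose = 1 :=
  mul_eq_one_comm.mp hM.1

/-- Every unit vector is the first row of a special orthogonal matrix. -/
theorem exists_SO3_first_row {a b c : ℝ} (h : a ^ 2 + b ^ 2 + c ^ 2 = 1) :
    ∃ M, SO3 M ∧ M 0 0 = a ∧ M 0 1 = b ∧ M 0 2 = c := by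
  by_cases ha : 1 + a = 0
  · obtain rfl : a = -1 := by linarith
    have hb : b = 0 := by nlinarith [sq_nonneg b, sq_nonneg c]
    have hc : c = 0 := by nlinarith [sq_nonneg b, sq_nonneg c]
    subst hb hc
    refine ⟨!![-1, 0, 0; 0, -1, 0; 0, 0, 1], ⟨?_, ?_⟩, rfl, rfl, rfl⟩
    · ext i j
      fin_cases i <;> fin_cases j <;>
        simp [Matrix.mul_apply, Fin.sum_univ_three]
    · simp [Matrix.det_fin_three]
  · obtain ⟨t, ht⟩ : ∃ t, (1 + a) * t = 1 := ⟨_, mul_inv_cancel₀ ha⟩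
    refine ⟨!![a, b, c; -b, 1 - b ^ 2 * t, -(b * c * t); -c, -(b * c * t), 1 - c ^ 2 * t],
      ⟨?_, ?_⟩, rfl, rfl, rfl⟩
    · ext i j
      fin_cases i <;> fin_cases j <;>
        simp [Matrix.mul_apply, Fin.sum_univ_three] <;> grind
    · simp [Matrix.det_fin_three]
      grind

theorem exists_SO3_mul_col_eq_zero (R : Matrix (Fin 3) (Fin 3) ℝ) :
    ∃ M, SO3 M ∧ (M * R) 1 0 = 0 ∧ (M * R) 2 0 = 0 := by
  set n := colNorm3 R with hn
  have hsq : n ^ 2 = R 0 0 ^ 2 + R 1 0 ^ 2 + R 2 0 ^ 2 := Real.sq_sqrt (by positivity)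
  by_cases h0 : n = 0
  · rw [h0] at hsq
    refine ⟨1, SO3.one, ?_, ?_⟩ <;> rw [Matrix.one_mul] <;>
      nlinarith [sq_nonneg (R 0 0), sq_nonneg (R 1 0), sq_nonneg (R 2 0)]
  · obtain ⟨M, hM, ha, hb, hc⟩ := exists_SO3_first_row
      (a := R 0 0 / n) (b := R 1 0 / n) (c := R 2 0 / n) (by field_simp; linarith)
    rw [eq_div_iff h0] at ha hb hc
    have h₁ := congrFun₂ hM.mul_transpose 1 0
    have h₂ := congrFun₂ hM.mul_transpose 2 0
    simp [Matrix.mul_apply, Fin.sum_univ_three] at h₁ h₂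
    refine ⟨M, hM, ?_, ?_⟩ <;> rw [Matrix.mul_apply, Fin.sum_univ_three, ← ha, ← hb, ← hc]
    · linear_combination n * h₁
    · linear_combination n * h₂

theorem SO3.mul_col_eq_zero {M R : Matrix (Fin 3) (Fin 3) ℝ} (hM : SO3 M) {c : ℝ}
    (h : ∀ j, M 0 j = c * R j 0) : (M * R) 1 0 = 0 ∧ (M * R) 2 0 = 0 := by
  have h₀ := congrFun₂ hM.mul_transpose 0 0
  have h₁ := congrFun₂ hM.mul_transpose 1 0
  have h₂ := congrFun₂ hM.mul_transpose 2 0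
  simp [Matrix.mul_apply, Fin.sum_univ_three, h] at h₀ h₁ h₂
  have hc : c ≠ 0 := by
    rintro rfl
    simp at h₀
  constructor <;> rw [Matrix.mul_apply, Fin.sum_univ_three] <;> refine mul_left_cancel₀ hc ?_
  · linear_combination h₁
  · linear_combination h₂

theorem colNorm3_mul_diagonal_mul_le_one {P Q : Matrix (Fin 3) (Fin 3) ℝ} (hP : SO3 P)
    (hQ : SO3 Q) {d : Fin 3 → ℝ} (hd : ∀ i, d i ^ 2 ≤ 1) :
    colNorm3 (P * Matrix.diagonal d * Q) ≤ 1 := by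
  have hQ0 := congrFun₂ hQ.1 0 0
  simp [Matrix.mul_apply, Fin.sum_univ_three] at hQ0
  have key : (P * Matrix.diagonal d * Q).transpose * (P * Matrix.diagonal d * Q) =
      (Matrix.diagonal d * Q).transpose * (Matrix.diagonal d * Q) := by
    rw [Matrix.mul_assoc P, Matrix.transpose_mul, Matrix.mul_assoc, ← Matrix.mul_assoc P.transpose,
      hP.1, Matrix.one_mul]
  rw [colNorm3_eq_sqrt_transpose_mul, key, Real.sqrt_le_one]
  simp only [Matrix.mul_apply (M := (Matrix.diagonal d * Q).transpose), Fin.sum_univ_three,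
    Matrix.transpose_apply, Matrix.diagonal_mul]
  nlinarith [mul_le_mul_of_nonneg_right (hd 0) (sq_nonneg (Q 0 0)),
    mul_le_mul_of_nonneg_right (hd 1) (sq_nonneg (Q 1 0)),
    mul_le_mul_of_nonneg_right (hd 2) (sq_nonneg (Q 2 0))]

theorem stmt4 (ez ex ey : ℝ)
    (hqi : 0 ≤ (1 + ez + ex + ey) / 4) (hqz : 0 ≤ (1 + ez - ex - ey) / 4)
    (hqx : 0 ≤ (1 - ez + ex - ey) / 4) (hqy : 0 ≤ (1 - ez - ex + ey) / 4)
    (A B : Matrix (Fin 3) (Fin 3) ℝ) (hA : SO3 A) (hB : SO3 B)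
    (R : Matrix (Fin 3) (Fin 3) ℝ)
    (hR : R = B * Matrix.diagonal ![ez, ex, ey] * A)
    (H : ℝ)
    (hH : H = -((1 + ez + ex + ey) / 4 * Real.logb 2 ((1 + ez + ex + ey) / 4)
      + (1 + ez - ex - ey) / 4 * Real.logb 2 ((1 + ez - ex - ey) / 4)
      + (1 - ez + ex - ey) / 4 * Real.logb 2 ((1 - ez + ex - ey) / 4)
      + (1 - ez - ex + ey) / 4 * Real.logb 2 ((1 - ez - ex + ey) / 4)))
    (K : Matrix (Fin 3) (Fin 3) ℝ → ℝ)
    (hK : ∀ M, K M = 1 - H + h2 ((1 + colNorm3 M) / 2) - h2 ((1 + M 0 0) / 2)) :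
    (∃ OB, SO3 OB ∧ K (OB * R) = 1 - H) ∧
    sSup {r : ℝ | ∃ OB, SO3 OB ∧ r = K (OB * R)} = 1 - H ∧
    sSup {r : ℝ | ∃ OA OB, SO3 OA ∧ SO3 OB ∧ r = K (OB * R * OA)} = 1 - H ∧
    (∀ OB, SO3 OB → (∃ c : ℝ, ∀ j, OB 0 j = c * R j 0) → K (OB * R) = 1 - H) := by
  have hd : ∀ i, (![ez, ex, ey] : Fin 3 → ℝ) i ^ 2 ≤ 1 := by
    intro i
    fin_cases i <;> simp only [sq_le_one_iff_abs_le_one, abs_le] <;> constructor <;>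
      simp <;> linarith
  have heq : ∀ M : Matrix (Fin 3) (Fin 3) ℝ, M 1 0 = 0 ∧ M 2 0 = 0 → K M = 1 - H := by
    intro M hM
    rw [hK, colNorm3_eq_abs hM.1 hM.2, h2_half_one_add_abs]
    ring
  have hle : ∀ OA OB, SO3 OA → SO3 OB → K (OB * R * OA) ≤ 1 - H := by
    intro OA OB hOA hOB
    have hnorm : colNorm3 (OB * R * OA) ≤ 1 := by
      have := colNorm3_mul_diagonal_mul_le_one (hOB.mul hB) (hA.mul hOA) hd
      simpa only [hR, Matrix.mul_assoc] using this
    rw [hK]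
    linarith [h2_half_one_add_le (abs_le_colNorm3 (OB * R * OA)) hnorm]
  obtain ⟨O, hO, hcol⟩ := exists_SO3_mul_col_eq_zero R
  have hKO := heq _ hcol
  refine ⟨⟨O, hO, hKO⟩, IsGreatest.csSup_eq ⟨⟨O, hO, hKO.symm⟩, ?_⟩,
    IsGreatest.csSup_eq ⟨⟨1, O, SO3.one, hO, by rw [Matrix.mul_one, hKO]⟩, ?_⟩, ?_⟩
  · rintro _ ⟨OB, hOB, rfl⟩
    simpa using hle 1 OB SO3.one hOB
  · rintro _ ⟨OA, OB, hOA, hOB, rfl⟩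
    exact hle OA OB hOA hOB
  · rintro OB hOB ⟨c, hc⟩
    exact heq _ (hOB.mul_col_eq_zero hc)
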